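/- arXiv:0901.4028 — 3 statements merged into one kernel-verified Lean document; each statement's English description precedes it below -/
import Mathlib

section
/- Let n ≥ 1 be an integer, a > 0 and b ∈ ℝ. Then ∫_0^∞ p^{2n−1} cos(bp) ( ∫_1^∞ (k²−1)^{n−1} e^{−apk} dk ) dp = 2^{2n−2} Γ(n)² / (a² + b²)ⁿ. -/
open MeasureTheory Filter Real Set

noncomputable section

theorem one_sub_mul_sum_choose_mul_pow {R : Type*} [CommRing R] (m N : ℕ) (y : R) :
    (1 - y) * ∑ j ∈ Finset.range (N + 1), ((m + 1 + j).choose j : R) * y ^ j =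
      ∑ j ∈ Finset.range (N + 1), ((m + j).choose j : R) * y ^ j -
        ((m + 1 + N).choose N : R) * y ^ (N + 1) := by
  induction N with
  | zero => simp
  | succ N ih =>
    rw [Finset.sum_range_succ, mul_add, ih, Finset.sum_range_succ _ (N + 1)]
    have h : ((m + 1 + (N + 1)).choose (N + 1) : R) =
        ((m + 1 + N).choose N : R) + ((m + (N + 1)).choose (N + 1) : R) := by
      rw [← Nat.cast_add, show m + 1 + (N + 1) = (m + 1 + N) + 1 by ring, Nat.choose_succ_succ,
        show m + (N + 1) = m + 1 + N by ring]
    rw [h]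
    ring

/-- The Chaundy–Bullard identity. -/
theorem chaundy_bullard {R : Type*} [CommRing R] (m : ℕ) {x y : R} (h : x + y = 1) :
    x ^ (m + 1) * ∑ j ∈ Finset.range (m + 1), ((m + j).choose j : R) * y ^ j +
      y ^ (m + 1) * ∑ j ∈ Finset.range (m + 1), ((m + j).choose j : R) * x ^ j = 1 := by
  induction m with
  | zero => simpa using h
  | succ m ih =>
    have hc : ((m + 1 + (m + 1)).choose (m + 1) : R) = 2 * ((m + (m + 1)).choose (m + 1) : R) := by
      rw [show m + 1 + (m + 1) = (m + (m + 1)) + 1 by ring, Nat.choose_succ_succ,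
        show (m + (m + 1)).choose m = (m + (m + 1)).choose (m + 1) from
          Nat.choose_symm_of_eq_add rfl]
      push_cast
      ring
    have hy := one_sub_mul_sum_choose_mul_pow m (m + 1) y
    have hx := one_sub_mul_sum_choose_mul_pow m (m + 1) x
    rw [Finset.sum_range_succ (fun j => ((m + j).choose j : R) * y ^ j), hc] at hy
    rw [Finset.sum_range_succ (fun j => ((m + j).choose j : R) * x ^ j), hc] at hx
    obtain rfl : x = 1 - y := eq_sub_of_add_eq h
    rw [sub_sub_cancel] at hx
    rw [pow_succ (1 - y) (m + 1), pow_succ y (m + 1), mul_assoc, mul_assoc, hx, hy]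
    linear_combination ih

theorem norm_pow_mul_exp_neg_mul (k : ℕ) (z : ℂ) {t : ℝ} (ht : 0 ≤ t) :
    ‖(t : ℂ) ^ k * Complex.exp (-(z * t))‖ = t ^ k * Real.exp (-(z.re * t)) := by
  rw [norm_mul, norm_pow, Complex.norm_exp, Complex.norm_of_nonneg ht]
  simp

theorem integrableOn_pow_mul_exp_neg_mul_Ioi (k : ℕ) {z : ℂ} (hz : 0 < z.re) :
    IntegrableOn (fun t : ℝ => (t : ℂ) ^ k * Complex.exp (-(z * t))) (Ioi 0) := by
  have h := integrableOn_rpow_mul_exp_neg_mul_rpow (p := 1) (s := k)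
    (neg_one_lt_zero.trans_le k.cast_nonneg) one_pos hz
  refine Integrable.mono' h (by fun_prop) ?_
  filter_upwards [ae_restrict_mem measurableSet_Ioi] with t ht
  rw [norm_pow_mul_exp_neg_mul k z (le_of_lt ht), Real.rpow_natCast, Real.rpow_one, neg_mul]

theorem tendsto_pow_mul_exp_neg_mul_atTop (k : ℕ) {z : ℂ} (hz : 0 < z.re) :
    Tendsto (fun t : ℝ => (t : ℂ) ^ k * Complex.exp (-(z * t))) atTop (nhds 0) := by
  have h := ((Real.tendsto_pow_mul_exp_neg_atTop_nhds_zero k).comp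
    (tendsto_id.const_mul_atTop hz)).const_mul ((z.re ^ k)⁻¹)
  rw [mul_zero] at h
  refine tendsto_zero_iff_norm_tendsto_zero.mpr (h.congr' ?_)
  filter_upwards [eventually_ge_atTop 0] with t ht
  rw [norm_pow_mul_exp_neg_mul k z ht]
  simp only [Function.comp_apply, id_eq, mul_pow]
  field_simp

theorem integral_pow_mul_exp_neg_mul_Ioi (k : ℕ) {z : ℂ} (hz : 0 < z.re) :
    ∫ t in Ioi (0 : ℝ), (t : ℂ) ^ k * Complex.exp (-(z * t)) = k.factorial / z ^ (k + 1) := by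
  have hz0 : z ≠ 0 := by rintro rfl; simp at hz
  have hexp (t : ℝ) : HasDerivAt (fun t : ℝ => Complex.exp (-(z * t)))
      (Complex.exp (-(z * t)) * -(z * 1)) t :=
    ((Complex.ofRealCLM.hasDerivAt (x := t)).const_mul z).neg.cexp
  induction k with
  | zero =>
    have h := integral_Ioi_of_hasDerivAt_of_tendsto' (a := 0) (fun t _ => hexp t)
      (by simpa [IntegrableOn] using (integrableOn_pow_mul_exp_neg_mul_Ioi 0 hz).mul_const (-z))
      (by simpa using tendsto_pow_mul_exp_neg_mul_atTop 0 hz)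
    rw [integral_mul_const] at h
    simp only [pow_zero, one_mul, zero_add, pow_one, Nat.factorial_zero, Nat.cast_one]
    rw [eq_div_iff hz0]
    simp only [Complex.ofReal_zero, mul_zero, neg_zero, Complex.exp_zero] at h
    linear_combination -h
  | succ k ih =>
    have hd (t : ℝ) : HasDerivAt (fun t : ℝ => (t : ℂ) ^ (k + 1) * Complex.exp (-(z * t)))
        ((k + 1) * ((t : ℂ) ^ k * Complex.exp (-(z * t))) -
          z * ((t : ℂ) ^ (k + 1) * Complex.exp (-(z * t)))) t := by
      convert! ((Complex.ofRealCLM.hasDerivAt (x := t)).pow (k + 1)).mul (hexp t) using 1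
      simp
      ring
    have h1 := (integrableOn_pow_mul_exp_neg_mul_Ioi k hz).const_mul ((k : ℂ) + 1)
    have h2 := (integrableOn_pow_mul_exp_neg_mul_Ioi (k + 1) hz).const_mul z
    have h := integral_Ioi_of_hasDerivAt_of_tendsto' (a := 0) (fun t _ => hd t) (h1.sub h2)
      (tendsto_pow_mul_exp_neg_mul_atTop (k + 1) hz)
    rw [integral_sub h1 h2, integral_const_mul, integral_const_mul, ih] at h
    simp only [Complex.ofReal_zero, ne_eq, Nat.add_eq_zero_iff, one_ne_zero, and_false,
      not_false_eq_true, zero_pow, zero_mul, sub_zero] at h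
    refine mul_left_cancel₀ hz0 ((sub_eq_zero.mp h).symm.trans ?_)
    rw [Nat.factorial_succ]
    push_cast
    field_simp
    ring

theorem re_pow_mul_exp_neg_mul (k : ℕ) (a b t : ℝ) :
    ((t : ℂ) ^ k * Complex.exp (-((a + b * Complex.I) * t))).re =
      t ^ k * (Real.exp (-(a * t)) * Real.cos (b * t)) := by
  rw [← Complex.ofReal_pow, Complex.re_ofReal_mul, Complex.exp_re]
  simp

theorem integrableOn_pow_mul_exp_mul_cos_Ioi (k : ℕ) {a : ℝ} (b : ℝ) (ha : 0 < a) :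
    IntegrableOn (fun t : ℝ => t ^ k * (Real.exp (-(a * t)) * Real.cos (b * t))) (Ioi 0) := by
  have h := (integrableOn_pow_mul_exp_neg_mul_Ioi k (z := a + b * Complex.I) (by simpa)).re
  exact h.congr (ae_of_all _ fun t => re_pow_mul_exp_neg_mul k a b t)

theorem integral_pow_mul_exp_mul_cos_Ioi (k : ℕ) {a : ℝ} (b : ℝ) (ha : 0 < a) :
    ∫ t in Ioi (0 : ℝ), t ^ k * (Real.exp (-(a * t)) * Real.cos (b * t)) =
      (k.factorial / ((a : ℂ) + b * Complex.I) ^ (k + 1)).re := by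
  have hz : 0 < ((a : ℂ) + b * Complex.I).re := by simpa
  rw [← integral_pow_mul_exp_neg_mul_Ioi k hz]
  simp_rw [← re_pow_mul_exp_neg_mul]
  exact integral_re (integrableOn_pow_mul_exp_neg_mul_Ioi k hz)

theorem integral_sq_sub_one_pow_mul_exp_Ioi (m : ℕ) {q : ℝ} (hq : 0 < q) :
    ∫ k in Ioi (1 : ℝ), (k ^ 2 - 1) ^ m * Real.exp (-(q * k)) =
      ∑ j ∈ Finset.range (m + 1),
        m.choose j * 2 ^ (m - j) * ((m + j).factorial / q ^ (m + j + 1)) * Real.exp (-q) := by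
  have hI (k : ℕ) : IntegrableOn (fun t : ℝ => t ^ k * Real.exp (-(q * t))) (Ioi 0) := by
    simpa using integrableOn_pow_mul_exp_mul_cos_Ioi k 0 hq
  have hv (k : ℕ) : ∫ t in Ioi (0 : ℝ), t ^ k * Real.exp (-(q * t)) =
      k.factorial / q ^ (k + 1) := by
    have h := integral_pow_mul_exp_mul_cos_Ioi k 0 hq
    simp only [zero_mul, Real.cos_zero, mul_one, Complex.ofReal_zero, add_zero] at h
    rw [h]
    norm_cast
  have hs : ∫ k in Ioi (1 : ℝ), (k ^ 2 - 1) ^ m * Real.exp (-(q * k)) =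
      ∫ t in Ioi (0 : ℝ), ((t + 1) ^ 2 - 1) ^ m * Real.exp (-(q * (t + 1))) := by
    have h := (measurePreserving_add_right volume (1 : ℝ)).setIntegral_preimage_emb
      (measurableEmbedding_addRight 1) (fun k => (k ^ 2 - 1) ^ m * Real.exp (-(q * k))) (Ioi 1)
    rw [← h]
    simp
  rw [hs]
  have he (t : ℝ) : ((t + 1) ^ 2 - 1) ^ m * Real.exp (-(q * (t + 1))) =
      ∑ j ∈ Finset.range (m + 1), (m.choose j * 2 ^ (m - j) * Real.exp (-q)) *
        (t ^ (m + j) * Real.exp (-(q * t))) := by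
    rw [show (t + 1) ^ 2 - 1 = t * (t + 2) by ring, mul_pow, add_pow,
      show -(q * (t + 1)) = -(q * t) + -q by ring, Real.exp_add, Finset.mul_sum, Finset.sum_mul]
    refine Finset.sum_congr rfl fun j _ => ?_
    ring
  simp_rw [he]
  rw [integral_finsetSum _ fun j _ => (hI (m + j)).const_mul _]
  refine Finset.sum_congr rfl fun j _ => ?_
  rw [integral_const_mul, hv]
  ring

theorem sum_choose_mul_inv_pow_add_inv_pow {K : Type*} [Field K] (m : ℕ) {z w : K}
    (hz : z ≠ 0) (hw : w ≠ 0) (hs : z + w ≠ 0) :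
    ∑ j ∈ Finset.range (m + 1), ((m + j).choose j : K) / (z + w) ^ (m + j + 1) *
        (1 / z ^ (m - j + 1) + 1 / w ^ (m - j + 1)) = 1 / (z * w) ^ (m + 1) := by
  have h := chaundy_bullard m (x := z / (z + w)) (y := w / (z + w)) (by field_simp)
  refine Eq.trans ?_ (congrArg (fun x => x / (z * w) ^ (m + 1)) h)
  rw [Finset.mul_sum, Finset.mul_sum, ← Finset.sum_add_distrib, Finset.sum_div]
  clear h
  refine Finset.sum_congr rfl fun j hj => ?_
  obtain ⟨i, rfl⟩ := Nat.exists_eq_add_of_le (Finset.mem_range_succ_iff.mp hj)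
  rw [Nat.add_sub_cancel_left]
  simp only [div_pow, mul_pow]
  field_simp
  ring

/-- The Fourier-inversion double integral yielding the Poisson kernel of the
`n`-dimensional complex hyperbolic space:
`∫_0^∞ p^{2n-1} cos(bp) (∫_1^∞ (k²-1)^{n-1} e^{-apk} dk) dp = 2^{2n-2}Γ(n)²/(a²+b²)ⁿ`. -/
theorem double_integral_complex_poisson (n : ℕ) (hn : 1 ≤ n) (a b : ℝ) (ha : 0 < a) :
    ∫ p in Set.Ioi (0 : ℝ), p ^ (2 * n - 1) * Real.cos (b * p) *
        ∫ k in Set.Ioi (1 : ℝ), (k ^ 2 - 1) ^ (n - 1) * Real.exp (-(a * p * k)) =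
      2 ^ (2 * n - 2) * Real.Gamma n ^ 2 / (a ^ 2 + b ^ 2) ^ n := by
  obtain ⟨m, rfl⟩ := Nat.exists_eq_add_of_le' hn
  rw [show 2 * (m + 1) - 1 = 2 * m + 1 by omega, show 2 * (m + 1) - 2 = 2 * m by omega,
    Nat.add_sub_cancel, Nat.cast_succ, Real.Gamma_nat_eq_factorial]
  have he : ∀ p ∈ Ioi (0 : ℝ), (p ^ (2 * m + 1) * Real.cos (b * p) *
        ∫ k in Set.Ioi (1 : ℝ), (k ^ 2 - 1) ^ m * Real.exp (-(a * p * k))) =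
      ∑ j ∈ Finset.range (m + 1),
        (m.choose j * 2 ^ (m - j) * ((m + j).factorial / a ^ (m + j + 1))) *
          (p ^ (m - j) * (Real.exp (-(a * p)) * Real.cos (b * p))) := by
    intro p hp
    have hp : 0 < p := hp
    rw [integral_sq_sub_one_pow_mul_exp_Ioi m (mul_pos ha hp), Finset.mul_sum]
    refine Finset.sum_congr rfl fun j hj => ?_
    obtain ⟨i, rfl⟩ := Nat.exists_eq_add_of_le (Finset.mem_range_succ_iff.mp hj)
    rw [Nat.add_sub_cancel_left, mul_pow]
    field_simp
    ring
  rw [setIntegral_congr_fun measurableSet_Ioi he, integral_finsetSum _ fun j _ =>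
    (integrableOn_pow_mul_exp_mul_cos_Ioi (m - j) b ha).const_mul _]
  simp_rw [integral_const_mul, integral_pow_mul_exp_mul_cos_Ioi _ b ha]
  set z : ℂ := a + b * Complex.I with hzdef
  have hz : z ≠ 0 := fun h => ha.ne' (by simpa [hzdef] using congrArg Complex.re h)
  have hw : (starRingEnd ℂ) z ≠ 0 := by simpa using hz
  have hs : z + (starRingEnd ℂ) z = ((2 * a : ℝ) : ℂ) := by
    rw [Complex.add_conj]; simp [hzdef]
  have hs0 : z + (starRingEnd ℂ) z ≠ 0 := by
    rw [hs]; exact_mod_cast (by positivity : 2 * a ≠ 0)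
  have hp : z * (starRingEnd ℂ) z = ((a ^ 2 + b ^ 2 : ℝ) : ℂ) := by
    rw [Complex.mul_conj]; simp [hzdef, Complex.normSq_apply]; ring
  have key := sum_choose_mul_inv_pow_add_inv_pow m hz hw hs0
  have hre (i : ℕ) : (1 : ℂ) / z ^ i + 1 / (starRingEnd ℂ) z ^ i =
      ((2 * (1 / z ^ i).re : ℝ) : ℂ) := by
    rw [← Complex.add_conj]; simp
  simp_rw [hre, hs, hp] at key
  norm_cast at key
  rw [mul_div_assoc, div_eq_mul_one_div _ ((a ^ 2 + b ^ 2) ^ (m + 1)), ← key, Finset.mul_sum,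
    Finset.mul_sum]
  refine Finset.sum_congr rfl fun j hj => ?_
  obtain ⟨i, rfl⟩ := Nat.exists_eq_add_of_le (Finset.mem_range_succ_iff.mp hj)
  rw [Nat.add_sub_cancel_left, div_eq_mul_one_div ((i.factorial : ℕ) : ℂ), ← Complex.ofReal_natCast,
    Complex.re_ofReal_mul]
  have h1 : (((j + i).choose j : ℕ) : ℝ) = (j + i).factorial / (j.factorial * i.factorial) := by
    rw [Nat.cast_add_choose]
  have h2 : (((j + i + j).choose j : ℕ) : ℝ) =
      (j + i + j).factorial / ((j + i).factorial * j.factorial) := by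
    rw [← Nat.choose_symm_add, Nat.cast_add_choose]
  rw [h1, h2]
  have := Nat.cast_ne_zero (R := ℝ).mpr j.factorial_ne_zero
  have := Nat.cast_ne_zero (R := ℝ).mpr i.factorial_ne_zero
  have := Nat.cast_ne_zero (R := ℝ).mpr (j + i).factorial_ne_zero
  generalize (1 / z ^ (i + 1)).re = r
  field_simp
  ring
end
end

section
/- Let m ≥ 1 be an integer, a > 0 and b > 0. Then ∫_0^∞ r^{2m} sin(br) ( ∫_1^∞ (k²−1)^{m−1} e^{−ark} dk ) dr = 2^{2m−1} Γ(m) Γ(m+1) · b / (a² + b²)^{m+1}. -/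
open MeasureTheory Filter Real Set

noncomputable section

/-- The odd antiderivative of `(1 - z ^ 2) ^ n`. -/
def oneSubSqPowPrimitive : ℕ → ℂ → ℂ
  | 0, z => z
  | n + 1, z => (z * (1 - z ^ 2) ^ (n + 1) + (2 * n + 2) * oneSubSqPowPrimitive n z) / (2 * n + 3)

lemma two_mul_natCast_add_three_ne_zero (n : ℕ) : (2 * n + 3 : ℂ) ≠ 0 := by
  exact_mod_cast (by omega : 2 * n + 3 ≠ 0)

lemma hasDerivAt_oneSubSqPowPrimitive (n : ℕ) (z : ℂ) :
    HasDerivAt (oneSubSqPowPrimitive n) ((1 - z ^ 2) ^ n) z := by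
  induction n with
  | zero => exact (hasDerivAt_id z).congr_deriv (pow_zero _).symm
  | succ n ih =>
    have hpow : HasDerivAt (fun z : ℂ => (1 - z ^ 2) ^ (n + 1))
        ((n + 1) * (1 - z ^ 2) ^ n * (-(2 * z))) z := by
      simpa using ((hasDerivAt_pow 2 z).const_sub 1).fun_pow (n + 1)
    refine ((((hasDerivAt_id z).mul hpow).add (ih.const_mul (2 * n + 2 : ℂ))).div_const
      (2 * n + 3 : ℂ)).congr_deriv ?_
    rw [div_eq_iff (two_mul_natCast_add_three_ne_zero n)]
    simp only [id_eq]
    ring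

lemma oneSubSqPowPrimitive_neg_one (n : ℕ) :
    oneSubSqPowPrimitive n (-1) =
      ((-(4 ^ n * (n.factorial : ℝ) ^ 2 / ((2 * n + 1).factorial : ℝ)) : ℝ) : ℂ) := by
  induction n with
  | zero => simp [oneSubSqPowPrimitive]
  | succ n ih =>
    have h3 := two_mul_natCast_add_three_ne_zero n
    have h2 : (2 * n + 2 : ℂ) ≠ 0 := by exact_mod_cast (by omega : 2 * n + 2 ≠ 0)
    have hf : ((2 * n + 1).factorial : ℂ) ≠ 0 := by exact_mod_cast Nat.factorial_ne_zero _
    rw [oneSubSqPowPrimitive, ih, show 2 * (n + 1) + 1 = 2 * n + 1 + 1 + 1 by ring,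
      Nat.factorial_succ (2 * n + 1 + 1), Nat.factorial_succ (2 * n + 1), Nat.factorial_succ n]
    have h2' : (2 * n + 1 + 1 : ℂ) ≠ 0 := by convert h2 using 1; ring
    have h3' : (2 * n + 1 + 1 + 1 : ℂ) ≠ 0 := by convert h3 using 1; ring
    push_cast
    field_simp
    ring

lemma re_oneSubSqPowPrimitive_mul_I (n : ℕ) (y : ℝ) :
    (oneSubSqPowPrimitive n (y * Complex.I)).re = 0 := by
  induction n with
  | zero => simp [oneSubSqPowPrimitive]
  | succ n ih =>
    have h : oneSubSqPowPrimitive (n + 1) (y * Complex.I) =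
        (((1 + y ^ 2) ^ (n + 1) / (2 * n + 3) * y : ℝ) : ℂ) * Complex.I +
          (((2 * n + 2) / (2 * n + 3) : ℝ) : ℂ) * oneSubSqPowPrimitive n (y * Complex.I) := by
      rw [oneSubSqPowPrimitive, mul_pow, Complex.I_sq]
      push_cast
      ring
    rw [h, Complex.add_re, Complex.re_ofReal_mul, Complex.re_ofReal_mul, ih]
    simp

lemma ofReal_mul_sub_mul_I_ne_zero {a k : ℝ} (b : ℝ) (ha : 0 < a) (hk : 0 < k) :
    (a * k - b * Complex.I : ℂ) ≠ 0 := by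
  intro h
  have := congrArg Complex.re h
  simp at this
  rcases this with h | h <;> linarith

lemma ofReal_mul_le_norm_mul_sub_mul_I (a b k : ℝ) : a * k ≤ ‖(a * k - b * Complex.I : ℂ)‖ := by
  simpa using Complex.re_le_norm (a * k - b * Complex.I : ℂ)

lemma integrableOn_sq_sub_one_pow_div_pow {E : ℝ → ℂ} {a : ℝ} (n : ℕ) (ha : 0 < a)
    (hE : Continuous E) (hEa : ∀ k, a * k ≤ ‖E k‖) :
    IntegrableOn (fun k : ℝ => ((k : ℂ) ^ 2 - 1) ^ n / E k ^ (2 * n + 3)) (Ioi 1) := by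
  have hInt : IntegrableOn (fun k : ℝ => (a ^ (2 * n + 3))⁻¹ * k ^ (-3 : ℝ)) (Ioi 1) :=
    (integrableOn_Ioi_rpow_of_lt (by norm_num) one_pos).const_mul _
  refine Integrable.mono' hInt ?_ ?_
  · exact (by fun_prop : Measurable fun k : ℝ =>
      ((k : ℂ) ^ 2 - 1) ^ n / E k ^ (2 * n + 3)).aestronglyMeasurable
  · filter_upwards [ae_restrict_mem measurableSet_Ioi] with k hk
    have hk1 : 1 < k := hk
    have hk0 : 0 < k := by linarith
    have hnum : ‖(k : ℂ) ^ 2 - 1‖ ≤ k ^ 2 := by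
      rw [show (k : ℂ) ^ 2 - 1 = ((k ^ 2 - 1 : ℝ) : ℂ) by push_cast; rfl, Complex.norm_real,
        Real.norm_of_nonneg (by nlinarith)]
      linarith
    rw [norm_div, norm_pow, norm_pow]
    calc ‖(k : ℂ) ^ 2 - 1‖ ^ n / ‖E k‖ ^ (2 * n + 3)
        ≤ (k ^ 2) ^ n / (a * k) ^ (2 * n + 3) := by gcongr; exact hEa k
      _ = (a ^ (2 * n + 3))⁻¹ * k ^ (-3 : ℝ) := by
        rw [Real.rpow_neg hk0.le, show (3 : ℝ) = ((3 : ℕ) : ℝ) by norm_num, Real.rpow_natCast]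
        field_simp
        ring

lemma hasDerivAt_antideriv_sq_sub_one_pow_div {a b k : ℝ} (n : ℕ) (ha : 0 < a) (hk : 0 < k) :
    HasDerivAt (fun k : ℝ =>
      b * Complex.I * oneSubSqPowPrimitive n ((b * Complex.I * k - a) / (a * k - b * Complex.I)) +
        a / (2 * (n + 1)) * (1 - ((b * Complex.I * k - a) / (a * k - b * Complex.I)) ^ 2) ^ (n + 1))
      ((a ^ 2 + b ^ 2) ^ (n + 2) *
        (((k : ℂ) ^ 2 - 1) ^ n / (a * k - b * Complex.I) ^ (2 * n + 3))) k := by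
  have hE := ofReal_mul_sub_mul_I_ne_zero b ha hk
  set v : ℝ → ℂ := fun k => (b * Complex.I * k - a) / (a * k - b * Complex.I) with hv_def
  have hv : HasDerivAt v ((a ^ 2 + b ^ 2) / (a * k - b * Complex.I) ^ 2) k := by
    have hid : HasDerivAt (fun k : ℝ => (k : ℂ)) 1 k := Complex.ofRealCLM.hasDerivAt
    refine (((hid.const_mul (b * Complex.I)).sub_const (a : ℂ)).fun_div
      ((hid.const_mul (a : ℂ)).sub_const (b * Complex.I)) hE).congr_deriv ?_
    congr 1
    linear_combination (-(b : ℂ) ^ 2) * Complex.I_sq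
  have hn : (n + 1 : ℂ) ≠ 0 := by exact_mod_cast n.succ_ne_zero
  have hsq : 1 - v k ^ 2 =
      (a ^ 2 + b ^ 2) * ((k : ℂ) ^ 2 - 1) / (a * k - b * Complex.I) ^ 2 := by
    simp only [hv_def]
    rw [div_pow, eq_div_iff (pow_ne_zero 2 hE), sub_mul, div_mul_cancel₀ _ (pow_ne_zero 2 hE)]
    linear_combination ((b : ℂ) ^ 2 - b ^ 2 * k ^ 2) * Complex.I_sq
  have hlin : b * Complex.I - a * v k = (a ^ 2 + b ^ 2) / (a * k - b * Complex.I) := by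
    simp only [hv_def]
    field_simp
    linear_combination (-(b : ℂ) ^ 2) * Complex.I_sq
  have hP := (hasDerivAt_oneSubSqPowPrimitive n (v k)).comp_of_eq k hv rfl
  have hQ := ((hv.fun_pow 2).const_sub 1).fun_pow (n + 1)
  refine ((hP.const_mul (b * Complex.I)).add
    (hQ.const_mul ((a : ℂ) / (2 * (n + 1))))).congr_deriv ?_
  calc _ = (1 - v k ^ 2) ^ n * (b * Complex.I - a * v k) *
        ((a ^ 2 + b ^ 2) / (a * k - b * Complex.I) ^ 2) := by
        push_cast
        simp only [pow_one]
        field_simp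
        ring
    _ = _ := by
        rw [hsq, hlin]
        generalize (a * k - b * Complex.I : ℂ) = E at hE
        rw [div_pow, mul_pow, div_mul_div_comm, div_mul_div_comm, ← mul_div_assoc]
        congr 1 <;> ring

lemma im_integral_sq_sub_one_pow_div {a b : ℝ} (n : ℕ) (ha : 0 < a) :
    (∫ k in Ioi (1 : ℝ), ((k : ℂ) ^ 2 - 1) ^ n / (a * k - b * Complex.I) ^ (2 * n + 3)).im =
      b * (4 ^ n * (n.factorial : ℝ) ^ 2 / ((2 * n + 1).factorial : ℝ)) /
        (a ^ 2 + b ^ 2) ^ (n + 2) := by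
  have haC : (a : ℂ) ≠ 0 := by exact_mod_cast ha.ne'
  have hInt := integrableOn_sq_sub_one_pow_div_pow n ha
    (by fun_prop : Continuous fun k : ℝ => (a * k - b * Complex.I : ℂ))
    (ofReal_mul_le_norm_mul_sub_mul_I a b)
  have hlim : Tendsto (fun k : ℝ => (b * Complex.I * k - a : ℂ) / (a * k - b * Complex.I)) atTop
      (nhds ((b / a : ℝ) * Complex.I)) := by
    have hinv : Tendsto (fun k : ℝ => ((k⁻¹ : ℝ) : ℂ)) atTop (nhds 0) := by
      exact (Complex.continuous_ofReal.tendsto 0).comp tendsto_inv_atTop_zero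
    have h : Tendsto (fun k : ℝ => (b * Complex.I - a * ((k⁻¹ : ℝ) : ℂ)) /
        (a - b * Complex.I * ((k⁻¹ : ℝ) : ℂ))) atTop
        (nhds ((b * Complex.I - a * 0) / (a - b * Complex.I * 0))) :=
      (tendsto_const_nhds.sub (hinv.const_mul _)).div
        (tendsto_const_nhds.sub (hinv.const_mul _)) (by simpa using haC)
    have heq : (b * Complex.I - a * 0) / (a - b * Complex.I * 0) =
        ((b / a : ℝ) : ℂ) * Complex.I := by
      push_cast
      ring
    rw [heq] at h
    refine h.congr' ?_
    filter_upwards [eventually_gt_atTop 0] with k hk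
    have hkC : (k : ℂ) ≠ 0 := by exact_mod_cast hk.ne'
    rw [← mul_div_mul_right _ _ hkC]
    push_cast
    congr 1 <;> field_simp
  have hcont : Continuous (oneSubSqPowPrimitive n) :=
    continuous_iff_continuousAt.2 fun z => (hasDerivAt_oneSubSqPowPrimitive n z).continuousAt
  have hprim : Continuous fun z : ℂ => b * Complex.I * oneSubSqPowPrimitive n z +
      a / (2 * (n + 1)) * (1 - z ^ 2) ^ (n + 1) := by fun_prop
  have key := integral_Ioi_of_hasDerivAt_of_tendsto'
    (fun k (hk : k ∈ Ici (1 : ℝ)) =>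
      hasDerivAt_antideriv_sq_sub_one_pow_div (b := b) n ha (zero_lt_one.trans_le hk))
    (hInt.const_mul _) ((hprim.tendsto _).comp hlim)
  have hone : (b * Complex.I * (1 : ℝ) - a) / (a * (1 : ℝ) - b * Complex.I) = -1 := by
    rw [div_eq_iff (ofReal_mul_sub_mul_I_ne_zero b ha one_pos)]
    push_cast
    ring
  have hend : (a / (2 * (n + 1)) * (1 - ((b / a : ℝ) * Complex.I) ^ 2) ^ (n + 1) : ℂ) =
      ((a / (2 * (n + 1)) * (1 + (b / a) ^ 2) ^ (n + 1) : ℝ) : ℂ) := by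
    rw [mul_pow, Complex.I_sq]
    push_cast
    ring
  have hbI : ∀ z : ℂ, (b * Complex.I * z).im = b * z.re := fun z => by
    rw [mul_assoc, Complex.im_ofReal_mul]; simp
  have hS : (a ^ 2 + b ^ 2) ^ (n + 2) ≠ 0 := by positivity
  rw [integral_const_mul, hone, oneSubSqPowPrimitive_neg_one,
    show ((a : ℂ) ^ 2 + b ^ 2) ^ (n + 2) = (((a ^ 2 + b ^ 2) ^ (n + 2) : ℝ) : ℂ) by
      push_cast; rfl] at key
  have him := congrArg Complex.im key
  rw [Complex.im_ofReal_mul, Complex.sub_im, hend, Complex.add_im, Complex.add_im, hbI, hbI,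
    re_oneSubSqPowPrimitive_mul_I, Complex.ofReal_im, Complex.ofReal_re] at him
  rw [eq_div_iff hS, mul_comm, him]
  simp

lemma integrableOn_pow_mul_exp_neg_mul_Ioi_s14 (N : ℕ) {c : ℝ} (hc : 0 < c) :
    IntegrableOn (fun r : ℝ => r ^ N * Real.exp (-(c * r))) (Ioi 0) := by
  have h := integrableOn_rpow_mul_exp_neg_mul_rpow (p := 1) (s := N) (b := c)
    (by have := N.cast_nonneg (α := ℝ); linarith) one_pos hc
  simpa using h

lemma norm_pow_mul_cexp_neg_mul (N : ℕ) (c : ℂ) {r : ℝ} (hr : 0 ≤ r) :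
    ‖(r : ℂ) ^ N * Complex.exp (-(c * r))‖ = r ^ N * Real.exp (-(c.re * r)) := by
  rw [norm_mul, norm_pow, Complex.norm_real, Real.norm_of_nonneg hr, Complex.norm_exp]
  simp

lemma integrableOn_pow_mul_cexp_neg_mul_Ioi (N : ℕ) {c : ℂ} (hc : 0 < c.re) :
    IntegrableOn (fun r : ℝ => (r : ℂ) ^ N * Complex.exp (-(c * r))) (Ioi 0) := by
  refine (integrableOn_pow_mul_exp_neg_mul_Ioi_s14 N hc).mono'
    (by fun_prop : Continuous fun r : ℝ =>
      (r : ℂ) ^ N * Complex.exp (-(c * r))).aestronglyMeasurable ?_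
  filter_upwards [ae_restrict_mem measurableSet_Ioi] with r hr
  exact (norm_pow_mul_cexp_neg_mul N c (mem_Ioi.1 hr).le).le

lemma integral_pow_mul_cexp_neg_mul_Ioi (N : ℕ) {c : ℂ} (hc : 0 < c.re) :
    ∫ r in Ioi (0 : ℝ), (r : ℂ) ^ N * Complex.exp (-(c * r)) = N.factorial / c ^ (N + 1) := by
  have hc0 : c ≠ 0 := fun h => by simp [h] at hc
  induction N with
  | zero =>
    have h := integral_exp_mul_complex_Ioi (a := -c) (by simpa using hc) 0
    simpa [neg_div_neg_eq] using h
  | succ N ih =>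
    have hderiv (r : ℝ) : HasDerivAt (fun r : ℝ => (r : ℂ) ^ (N + 1) * Complex.exp (-(c * r)))
        ((N + 1) * ((r : ℂ) ^ N * Complex.exp (-(c * r))) -
          c * ((r : ℂ) ^ (N + 1) * Complex.exp (-(c * r)))) r := by
      have hid : HasDerivAt (fun r : ℝ => (r : ℂ)) 1 r := Complex.ofRealCLM.hasDerivAt
      refine ((hid.fun_pow (N + 1)).fun_mul (hid.const_mul c).fun_neg.cexp).congr_deriv ?_
      push_cast
      ring
    have hlim : Tendsto (fun r : ℝ => (r : ℂ) ^ (N + 1) * Complex.exp (-(c * r))) atTop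
        (nhds 0) := by
      rw [tendsto_zero_iff_norm_tendsto_zero]
      refine (tendsto_rpow_mul_exp_neg_mul_atTop_nhds_zero (N + 1 : ℕ) c.re hc).congr' ?_
      filter_upwards [eventually_ge_atTop 0] with r hr
      rw [norm_pow_mul_cexp_neg_mul _ _ hr, Real.rpow_natCast, neg_mul]
    have hN := (integrableOn_pow_mul_cexp_neg_mul_Ioi N hc).const_mul (N + 1 : ℂ)
    have hN1 := (integrableOn_pow_mul_cexp_neg_mul_Ioi (N + 1) hc).const_mul c
    have key := integral_Ioi_of_hasDerivAt_of_tendsto' (fun r _ => hderiv r) (hN.sub hN1) hlim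
    rw [integral_sub hN hN1, integral_const_mul, integral_const_mul, ih] at key
    simp only [Complex.ofReal_zero, ne_eq, N.succ_ne_zero, not_false_eq_true, zero_pow, zero_mul,
      sub_zero] at key
    rw [Nat.factorial_succ, pow_succ, ← mul_right_inj' hc0, ← sub_eq_zero.1 key]
    push_cast
    field_simp

lemma integral_pow_mul_exp_neg_mul_Ioi_s14 (N : ℕ) {c : ℝ} (hc : 0 < c) :
    ∫ r in Ioi (0 : ℝ), r ^ N * Real.exp (-(c * r)) = N.factorial / c ^ (N + 1) := by
  have h := integral_pow_mul_cexp_neg_mul_Ioi N (c := c) (by simpa using hc)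
  have h2 : ∀ r : ℝ, (r : ℂ) ^ N * Complex.exp (-(c * r)) =
      ((r ^ N * Real.exp (-(c * r)) : ℝ) : ℂ) := fun r => by push_cast; rfl
  simp only [h2] at h
  rw [integral_complex_ofReal] at h
  exact_mod_cast h

lemma integral_pow_mul_sin_mul_exp_neg_mul_Ioi (N : ℕ) (b : ℝ) {c : ℝ} (hc : 0 < c) :
    ∫ r in Ioi (0 : ℝ), r ^ N * Real.sin (b * r) * Real.exp (-(c * r)) =
      ((N.factorial : ℂ) / (c - b * Complex.I) ^ (N + 1)).im := by
  rw [← integral_pow_mul_cexp_neg_mul_Ioi N (c := c - b * Complex.I) (by simpa using hc)]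
  have hInt := integrableOn_pow_mul_cexp_neg_mul_Ioi N (c := c - b * Complex.I) (by simpa using hc)
  refine Eq.trans ?_ (integral_im hInt)
  refine integral_congr_ae (ae_of_all _ fun r => ?_)
  have : -((c - b * Complex.I) * r) = ((-(c * r) : ℝ) : ℂ) + ((b * r : ℝ) : ℂ) * Complex.I := by
    push_cast; ring
  show _ = Complex.im _
  rw [this, ← Complex.ofReal_pow, Complex.im_ofReal_mul, Complex.exp_add, ← Complex.ofReal_exp,
    Complex.im_ofReal_mul, Complex.exp_ofReal_mul_I_im]
  ring

lemma integrable_prod_pow_mul_sin_mul_exp (n : ℕ) {a : ℝ} (b : ℝ) (ha : 0 < a) :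
    Integrable (fun p : ℝ × ℝ => p.1 ^ (2 * n + 2) * Real.sin (b * p.1) *
        ((p.2 ^ 2 - 1) ^ n * Real.exp (-(a * p.1 * p.2))))
      ((volume.restrict (Ioi 0)).prod (volume.restrict (Ioi 1))) := by
  have hmeas : Continuous fun p : ℝ × ℝ => p.1 ^ (2 * n + 2) *
      ((p.2 ^ 2 - 1) ^ n * Real.exp (-(a * p.1 * p.2))) := by fun_prop
  have hbase : Integrable (fun p : ℝ × ℝ => p.1 ^ (2 * n + 2) *
        ((p.2 ^ 2 - 1) ^ n * Real.exp (-(a * p.1 * p.2))))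
      ((volume.restrict (Ioi 0)).prod (volume.restrict (Ioi 1))) := by
    rw [integrable_prod_iff' hmeas.aestronglyMeasurable]
    constructor
    · filter_upwards [ae_restrict_mem measurableSet_Ioi] with k hk
      have hk0 : 0 < k := one_pos.trans hk
      refine ((integrableOn_pow_mul_exp_neg_mul_Ioi_s14 (2 * n + 2) (mul_pos ha hk0)).const_mul
        ((k ^ 2 - 1) ^ n)).congr (ae_of_all _ fun r => ?_)
      simp only [mul_right_comm a k r]
      ring
    · have hInt := (integrableOn_sq_sub_one_pow_div_pow (E := fun k => ((a * k : ℝ) : ℂ)) n ha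
        (by fun_prop) (fun k => by simpa using le_abs_self (a * k))).norm.const_mul
          ((2 * n + 2).factorial : ℝ)
      refine hInt.congr ?_
      filter_upwards [ae_restrict_mem measurableSet_Ioi] with k hk
      have hk1 : 1 < k := hk
      have hk0 : 0 < k := one_pos.trans hk
      have hk2 : 0 ≤ k ^ 2 - 1 := by nlinarith
      have hnorm : ‖((k : ℂ) ^ 2 - 1) ^ n / ((a * k : ℝ) : ℂ) ^ (2 * n + 3)‖ =
          (k ^ 2 - 1) ^ n / (a * k) ^ (2 * n + 3) := by
        rw [show ((k : ℂ) ^ 2 - 1) ^ n / ((a * k : ℝ) : ℂ) ^ (2 * n + 3) =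
          (((k ^ 2 - 1) ^ n / (a * k) ^ (2 * n + 3) : ℝ) : ℂ) by push_cast; rfl,
          Complex.norm_real, Real.norm_of_nonneg (by positivity)]
      rw [hnorm]
      calc _ = (k ^ 2 - 1) ^ n * ((2 * n + 2).factorial / (a * k) ^ (2 * n + 2 + 1)) := by ring
        _ = _ := by
          rw [← integral_pow_mul_exp_neg_mul_Ioi_s14 (2 * n + 2) (mul_pos ha hk0),
            ← integral_const_mul]
          refine setIntegral_congr_fun measurableSet_Ioi fun r hr => ?_
          have hr0 : 0 < r := hr
          rw [Real.norm_of_nonneg (by positivity), mul_right_comm a k r]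
          ring
  refine hbase.mono (by fun_prop : Continuous fun p : ℝ × ℝ =>
    p.1 ^ (2 * n + 2) * Real.sin (b * p.1) *
      ((p.2 ^ 2 - 1) ^ n * Real.exp (-(a * p.1 * p.2)))).aestronglyMeasurable
    (ae_of_all _ fun p => ?_)
  rw [mul_right_comm, norm_mul]
  exact mul_le_of_le_one_right (norm_nonneg _) (Real.abs_sin_le_one _)

/-- The Fourier-inversion double integral yielding the Poisson kernel of the
quaternionic hyperbolic space:
`∫_0^∞ r^{2m} sin(br) (∫_1^∞ (k²-1)^{m-1} e^{-ark} dk) dr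
  = 2^{2m-1}Γ(m)Γ(m+1) b/(a²+b²)^{m+1}`. -/
theorem double_integral_quaternionic_poisson (m : ℕ) (hm : 1 ≤ m) (a b : ℝ)
    (ha : 0 < a) (hb : 0 < b) :
    ∫ r in Set.Ioi (0 : ℝ), r ^ (2 * m) * Real.sin (b * r) *
        ∫ k in Set.Ioi (1 : ℝ), (k ^ 2 - 1) ^ (m - 1) * Real.exp (-(a * r * k)) =
      2 ^ (2 * m - 1) * Real.Gamma m * Real.Gamma (m + 1) * b /
        (a ^ 2 + b ^ 2) ^ (m + 1) := by
  obtain ⟨n, rfl⟩ := Nat.exists_eq_add_of_le' hm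
  rw [show 2 * (n + 1) - 1 = 2 * n + 1 by omega, Real.Gamma_nat_eq_factorial,
    Nat.cast_succ, Real.Gamma_nat_eq_factorial, Nat.add_sub_cancel]
  simp only [← integral_const_mul]
  rw [integral_integral_swap (integrable_prod_pow_mul_sin_mul_exp n b ha)]
  have hinner : ∀ k ∈ Ioi (1 : ℝ),
      ∫ r in Ioi (0 : ℝ), r ^ (2 * (n + 1)) * Real.sin (b * r) *
        ((k ^ 2 - 1) ^ n * Real.exp (-(a * r * k))) =
      ((2 * n + 2).factorial : ℝ) *
        (((k : ℂ) ^ 2 - 1) ^ n / (a * k - b * Complex.I) ^ (2 * n + 3)).im := by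
    intro k hk
    have h := integral_pow_mul_sin_mul_exp_neg_mul_Ioi (2 * n + 2) b
      (mul_pos ha (one_pos.trans hk))
    calc _ = (k ^ 2 - 1) ^ n *
          ∫ r in Ioi (0 : ℝ), r ^ (2 * n + 2) * Real.sin (b * r) * Real.exp (-(a * k * r)) := by
          rw [← integral_const_mul]
          congr 1 with r
          rw [mul_right_comm a k r, show 2 * (n + 1) = 2 * n + 2 by ring]
          ring
      _ = _ := by
          rw [h, ← Complex.im_ofReal_mul, ← Complex.im_ofReal_mul]
          push_cast
          congr 1
          ring
  have hInt := integrableOn_sq_sub_one_pow_div_pow n ha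
    (by fun_prop : Continuous fun k : ℝ => (a * k - b * Complex.I : ℂ))
    (ofReal_mul_le_norm_mul_sub_mul_I a b)
  have him : ∫ k in Ioi (1 : ℝ),
      (((k : ℂ) ^ 2 - 1) ^ n / (a * k - b * Complex.I) ^ (2 * n + 3)).im = _ := integral_im hInt
  rw [setIntegral_congr_fun measurableSet_Ioi hinner, integral_const_mul, him, RCLike.im_eq_complex_im,
    im_integral_sq_sub_one_pow_div n ha, Nat.factorial_succ (2 * n + 1), Nat.factorial_succ n]
  have hf : ((2 * n + 1).factorial : ℝ) ≠ 0 := by exact_mod_cast Nat.factorial_ne_zero _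
  push_cast
  rw [show (4 : ℝ) = 2 ^ 2 by norm_num, ← pow_mul]
  field_simp
  ring
end
end

section
/- Let μ > 0, λ > 0 and κ ∈ ℝ with κ < μ + 1/2. Then e^{−λ} (2λ)^{2μ} ∫_0^∞ e^{−2λt} t^{μ−κ−1/2} (1+t)^{μ+κ−1/2} dt = (λ^{2μ+1}/2) ∫_0^∞ exp(−λ coth(λv/2)) (sinh(λv/2))^{−(2μ+1)} e^{λκv} dv; both integrals are finite. -/
open MeasureTheory Filter Real Set

noncomputable section

theorem integrableOn_exp_neg_mul_rpow_mul_one_add_rpow {c a b : ℝ} (hc : 0 < c) (ha : -1 < a) :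
    IntegrableOn (fun t : ℝ => Real.exp (-c * t) * t ^ a * (1 + t) ^ b) (Set.Ioi 0) := by
  have h1 := integrableOn_rpow_mul_exp_neg_mul_rpow (p := 1) (s := a) ha one_pos hc
  have h2 := integrableOn_rpow_mul_exp_neg_mul_rpow (p := 1) (s := a + |b|)
    (by linarith [abs_nonneg b]) one_pos hc
  have hmeas : Measurable fun t : ℝ => Real.exp (-c * t) * t ^ a * (1 + t) ^ b := by fun_prop
  refine Integrable.mono' ((h1.add h2).const_mul ((2 : ℝ) ^ |b|)) hmeas.aestronglyMeasurable ?_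
  filter_upwards [ae_restrict_mem measurableSet_Ioi] with t ht
  have ht : 0 < t := ht
  have hbound : (1 + t) ^ b ≤ 2 ^ |b| * (1 + t ^ |b|) := by
    have hpow : 0 ≤ t ^ |b| := by positivity
    calc (1 + t) ^ b ≤ (1 + t) ^ |b| :=
          Real.rpow_le_rpow_of_exponent_le (by linarith) (le_abs_self b)
      _ ≤ (2 * max 1 t) ^ |b| := by
          refine Real.rpow_le_rpow (by positivity) ?_ (abs_nonneg b)
          linarith [le_max_left 1 t, le_max_right 1 t]
      _ = 2 ^ |b| * (max 1 t) ^ |b| := Real.mul_rpow (by norm_num) (by positivity)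
      _ ≤ 2 ^ |b| * (1 + t ^ |b|) := by
          gcongr
          rcases max_cases 1 t with ⟨h, _⟩ | ⟨h, _⟩ <;> rw [h]
          · simpa using hpow
          · linarith
  rw [Real.norm_of_nonneg (by positivity)]
  calc Real.exp (-c * t) * t ^ a * (1 + t) ^ b
      ≤ Real.exp (-c * t) * t ^ a * (2 ^ |b| * (1 + t ^ |b|)) := by gcongr
    _ = _ := by
      simp only [Pi.add_apply, Real.rpow_one, Real.rpow_add ht]
      ring

theorem hasDerivAt_inv_exp_mul_sub_one {l v : ℝ} (h : Real.exp (l * v) - 1 ≠ 0) :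
    HasDerivAt (fun v : ℝ => (Real.exp (l * v) - 1)⁻¹)
      (-(l * Real.exp (l * v)) / (Real.exp (l * v) - 1) ^ 2) v := by
  have h1 : HasDerivAt (fun v : ℝ => Real.exp (l * v) - 1) (l * Real.exp (l * v)) v := by
    have := (((hasDerivAt_id v).const_mul l).exp).sub_const 1
    simpa [mul_comm] using this
  exact h1.inv h

theorem exp_mul_sub_one_pos {l v : ℝ} (hl : 0 < l) (hv : 0 < v) : 0 < Real.exp (l * v) - 1 :=
  sub_pos.2 (Real.one_lt_exp_iff.2 (mul_pos hl hv))

theorem image_inv_exp_mul_sub_one_Ioi {l : ℝ} (hl : 0 < l) :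
    (fun v : ℝ => (Real.exp (l * v) - 1)⁻¹) '' Set.Ioi 0 = Set.Ioi 0 := by
  ext t
  constructor
  · rintro ⟨v, hv, rfl⟩
    exact inv_pos.2 (exp_mul_sub_one_pos hl hv)
  · intro ht
    have hinv : 0 < t⁻¹ := inv_pos.2 ht
    refine ⟨Real.log (1 + t⁻¹) / l, div_pos (Real.log_pos (by linarith)) hl, ?_⟩
    simp only [mul_div_cancel₀ _ hl.ne']
    rw [Real.exp_log (by linarith)]
    simp

theorem injOn_inv_exp_mul_sub_one {l : ℝ} (hl : 0 < l) (s : Set ℝ) :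
    Set.InjOn (fun v : ℝ => (Real.exp (l * v) - 1)⁻¹) s := by
  intro v _ w _ h
  exact mul_left_cancel₀ hl.ne' (Real.exp_injective (sub_left_injective (inv_injective h)))

theorem abs_deriv_mul_whittaker_integrand {μ l κ v : ℝ} (hl : 0 < l) (hv : 0 < v) :
    |-(l * Real.exp (l * v)) / (Real.exp (l * v) - 1) ^ 2| *
      (Real.exp (-(2 * l) * (Real.exp (l * v) - 1)⁻¹) *
        (Real.exp (l * v) - 1)⁻¹ ^ (μ - κ - 1 / 2) *
        (1 + (Real.exp (l * v) - 1)⁻¹) ^ (μ + κ - 1 / 2)) =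
    Real.exp l * l * 2 ^ (-(2 * μ)) / 2 *
      (Real.exp (-(l * (Real.cosh (l * v / 2) / Real.sinh (l * v / 2)))) *
        Real.sinh (l * v / 2) ^ (-(2 * μ + 1)) * Real.exp (l * κ * v)) := by
  set s := Real.sinh (l * v / 2) with hs
  set E := Real.exp (l * v / 2) with hE
  have hs0 : 0 < s := Real.sinh_pos_iff.2 (by positivity)
  have hE0 : 0 < E := Real.exp_pos _
  have hEE : Real.exp (l * v) = E ^ 2 := by rw [hE, ← Real.exp_nat_mul]; congr 1; push_cast; ring
  have hsE : E - E⁻¹ = 2 * s := by rw [hs, Real.sinh_eq, hE, Real.exp_neg]; ring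
  have hcosh : Real.cosh (l * v / 2) = s + E⁻¹ := by
    rw [hs, Real.sinh_eq, Real.cosh_eq, hE, Real.exp_neg]; ring
  have hsub : Real.exp (l * v) - 1 = 2 * s * E := by
    rw [hEE, ← hsE]; field_simp
  have hone : 1 + (2 * s * E)⁻¹ = E / (2 * s) := by
    have : E ^ 2 - 1 = 2 * s * E := by rw [← hsub, hEE]
    field_simp
    linarith
  have habs : |-(l * Real.exp (l * v)) / (2 * s * E) ^ 2| = l / (4 * s ^ 2) := by
    rw [neg_div, abs_neg, abs_of_pos (by positivity), hEE]
    field_simp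
    norm_num
  have hcoth : -(2 * l) * (2 * s * E)⁻¹ = l + -(l * ((s + E⁻¹) / s)) := by
    field_simp
    ring
  have hpow : ((2 * s * E)⁻¹) ^ (μ - κ - 1 / 2) * (E / (2 * s)) ^ (μ + κ - 1 / 2) / (4 * s ^ 2) =
      2 ^ (-(2 * μ)) / 2 * s ^ (-(2 * μ + 1)) * Real.exp (l * κ * v) := by
    have hsx : s = Real.exp (Real.log s) := (Real.exp_log hs0).symm
    have h2x : (2 : ℝ) = Real.exp (Real.log 2) := (Real.exp_log two_pos).symm
    have hlogE : Real.log E = l * v / 2 := Real.log_exp _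
    have h4 : (4 : ℝ) * s ^ 2 = Real.exp (2 * Real.log 2 + 2 * Real.log s) := by
      rw [Real.exp_add, two_mul, two_mul, Real.exp_add, Real.exp_add, ← hsx, ← h2x]; ring
    have h2' : (2 : ℝ) ^ (-(2 * μ)) / 2 = Real.exp (Real.log 2 * (-(2 * μ)) - Real.log 2) := by
      rw [Real.exp_sub, ← h2x, Real.rpow_def_of_pos two_pos]
    rw [h4, h2', Real.rpow_def_of_pos (by positivity), Real.rpow_def_of_pos (by positivity),
      Real.rpow_def_of_pos hs0, Real.log_inv, Real.log_div hE0.ne' (by positivity),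
      Real.log_mul (by positivity) hE0.ne', Real.log_mul two_ne_zero hs0.ne', hlogE,
      ← Real.exp_add, ← Real.exp_sub, ← Real.exp_add, ← Real.exp_add]
    congr 1
    ring
  rw [hcosh, hsub, habs, hone, hcoth, Real.exp_add]
  linear_combination (l * Real.exp l * Real.exp (-(l * ((s + E⁻¹) / s)))) * hpow

/-- The change-of-variables identity `e^{λv} = 1 + t⁻¹` converting the Whittaker-type
integral into the conditional-Laplace-transform integral:
`e^{-λ}(2λ)^{2μ} ∫_0^∞ e^{-2λt} t^{μ-κ-1/2}(1+t)^{μ+κ-1/2} dt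
  = (λ^{2μ+1}/2) ∫_0^∞ e^{-λcoth(λv/2)} (sinh(λv/2))^{-(2μ+1)} e^{λκv} dv`,
and both integrals are finite. -/
theorem whittaker_integral_change_of_variables (μ l κ : ℝ)
    (hμ : 0 < μ) (hl : 0 < l) (hκ : κ < μ + 1 / 2) :
    IntegrableOn (fun t : ℝ =>
        Real.exp (-(2 * l) * t) * t ^ (μ - κ - 1 / 2) * (1 + t) ^ (μ + κ - 1 / 2))
      (Set.Ioi 0) ∧
    IntegrableOn (fun v : ℝ =>
        Real.exp (-(l * (Real.cosh (l * v / 2) / Real.sinh (l * v / 2)))) *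
          Real.sinh (l * v / 2) ^ (-(2 * μ + 1)) * Real.exp (l * κ * v))
      (Set.Ioi 0) ∧
    Real.exp (-l) * (2 * l) ^ (2 * μ) *
        ∫ t in Set.Ioi (0 : ℝ),
          Real.exp (-(2 * l) * t) * t ^ (μ - κ - 1 / 2) * (1 + t) ^ (μ + κ - 1 / 2) =
      l ^ (2 * μ + 1) / 2 *
        ∫ v in Set.Ioi (0 : ℝ),
          Real.exp (-(l * (Real.cosh (l * v / 2) / Real.sinh (l * v / 2)))) *
            Real.sinh (l * v / 2) ^ (-(2 * μ + 1)) * Real.exp (l * κ * v) := by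
  have hf := integrableOn_exp_neg_mul_rpow_mul_one_add_rpow (c := 2 * l) (a := μ - κ - 1 / 2)
    (b := μ + κ - 1 / 2) (by positivity) (by linarith)
  have hderiv : ∀ v ∈ Set.Ioi (0 : ℝ),
      HasDerivWithinAt (fun v : ℝ => (Real.exp (l * v) - 1)⁻¹)
        (-(l * Real.exp (l * v)) / (Real.exp (l * v) - 1) ^ 2) (Set.Ioi 0) v := fun v hv =>
    (hasDerivAt_inv_exp_mul_sub_one (exp_mul_sub_one_pos hl hv).ne').hasDerivWithinAt
  have hinj := injOn_inv_exp_mul_sub_one hl (Set.Ioi 0)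
  have hC : 0 < Real.exp l * l * 2 ^ (-(2 * μ)) / 2 := by positivity
  refine ⟨hf, ?_, ?_⟩
  · have hg := hf
    rw [← image_inv_exp_mul_sub_one_Ioi hl,
      integrableOn_image_iff_integrableOn_abs_deriv_smul measurableSet_Ioi hderiv hinj] at hg
    exact (integrable_const_mul_iff hC.ne'.isUnit _).1 (hg.congr_fun
      (fun v hv => abs_deriv_mul_whittaker_integrand hl hv) measurableSet_Ioi)
  · have hint := integral_image_eq_integral_abs_deriv_smul measurableSet_Ioi hderiv hinj
      (fun t : ℝ => Real.exp (-(2 * l) * t) * t ^ (μ - κ - 1 / 2) * (1 + t) ^ (μ + κ - 1 / 2))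
    rw [image_inv_exp_mul_sub_one_Ioi hl] at hint
    have hcongr := hint.trans (setIntegral_congr_fun measurableSet_Ioi
      fun v (hv : 0 < v) => abs_deriv_mul_whittaker_integrand (μ := μ) (κ := κ) hl hv)
    rw [hcongr, integral_const_mul, ← mul_assoc]
    congr 1
    rw [Real.mul_rpow two_pos.le hl.le, Real.rpow_add hl, Real.rpow_one, Real.exp_neg,
      Real.rpow_neg two_pos.le]
    field_simp
end
end
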